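/- arXiv:0908.3743 — 9 statements merged into one kernel-verified Lean document; each statement's English description precedes it below -/
import Mathlib

section
/- Let k be a field and m, n ≥ 1 integers. The kernel of the endomorphism T_{m,n} = J_m ⊗ I_n + I_m ⊗ J_n of k^m ⊗_k k^n has k-dimension min(m,n). Equivalently, the number of Jordan blocks in the Jordan normal form of T_{m,n} is min(m,n). -/
open TensorProduct

/-- The nilpotent Jordan block of size `n` (ones on the subdiagonal), as a linear
endomorphism of `Fin n → k`. -/
noncomputable def jordanBlock (k : Type) [Field k] (n : ℕ) : Module.End k (Fin n → k) :=
  Matrix.toLin' (Matrix.of fun i j : Fin n => if (i : ℕ) = (j : ℕ) + 1 then 1 else 0)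

/-- The endomorphism `J_m ⊗ I_n + I_m ⊗ J_n` of `k^m ⊗ k^n`. -/
noncomputable def jordanTensorSum (k : Type) [Field k] (m n : ℕ) :
    Module.End k (TensorProduct k (Fin m → k) (Fin n → k)) :=
  TensorProduct.map (jordanBlock k m) LinearMap.id +
    TensorProduct.map LinearMap.id (jordanBlock k n)

lemma jordanBlock_apply (k : Type) [Field k] (n : ℕ) (v : Fin n → k) (i : Fin n) :
    jordanBlock k n v i =
      if 0 < (i : ℕ) then v ⟨(i : ℕ) - 1, (Nat.sub_le _ _).trans_lt i.2⟩ else 0 := by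
  simp only [jordanBlock, Matrix.toLin'_apply, Matrix.mulVec, dotProduct, Matrix.of_apply,
    ite_mul, one_mul, zero_mul]
  split_ifs with h
  · rw [Finset.sum_eq_single ⟨(i : ℕ) - 1, (Nat.sub_le _ _).trans_lt i.2⟩]
    · rw [if_pos (by simp only; omega)]
    · intro b _ hb
      rw [if_neg]
      intro hi
      exact hb (Fin.ext (by simp only; omega))
    · simp
  · exact Finset.sum_eq_zero fun b _ => if_neg (by omega)

/-- Coordinates on `k^m ⊗ k^n` with respect to the tensor product of the standard bases. -/
noncomputable def tensorCoords (k : Type) [Field k] (m n : ℕ) :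
    TensorProduct k (Fin m → k) (Fin n → k) ≃ₗ[k] (Fin m × Fin n → k) :=
  ((Pi.basisFun k (Fin m)).tensorProduct (Pi.basisFun k (Fin n))).equivFun

lemma tensorCoords_tmul (k : Type) [Field k] (m n : ℕ) (v : Fin m → k) (w : Fin n → k)
    (p : Fin m × Fin n) : tensorCoords k m n (v ⊗ₜ w) p = v p.1 * w p.2 := by
  obtain ⟨i, j⟩ := p
  simp [tensorCoords, Module.Basis.equivFun_apply, Module.Basis.tensorProduct_repr_tmul_apply,
    mul_comm]

lemma tensorCoords_jordanTensorSum (k : Type) [Field k] (m n : ℕ)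
    (x : TensorProduct k (Fin m → k) (Fin n → k)) (i : Fin m) (j : Fin n) :
    tensorCoords k m n (jordanTensorSum k m n x) (i, j) =
      (if 0 < (i : ℕ) then
        tensorCoords k m n x (⟨(i : ℕ) - 1, (Nat.sub_le _ _).trans_lt i.2⟩, j) else 0) +
      (if 0 < (j : ℕ) then
        tensorCoords k m n x (i, ⟨(j : ℕ) - 1, (Nat.sub_le _ _).trans_lt j.2⟩) else 0) := by
  induction x using TensorProduct.induction_on with
  | zero => simp
  | tmul v w =>
    simp only [jordanTensorSum, LinearMap.add_apply, TensorProduct.map_tmul, map_add,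
      Pi.add_apply, tensorCoords_tmul, jordanBlock_apply, LinearMap.id_apply, ite_mul, mul_ite,
      zero_mul, mul_zero]
  | add x y hx hy =>
    simp only [map_add, Pi.add_apply, hx, hy]
    split_ifs <;> ring

section Kernel

variable {k : Type} [Field k] {m n : ℕ} {x : TensorProduct k (Fin m → k) (Fin n → k)}

lemma tensorCoords_succ_left (hx : jordanTensorSum k m n x = 0) {i j : ℕ} (hi : i + 1 < m)
    (hj : j + 1 < n) :
    tensorCoords k m n x (⟨i + 1, hi⟩, ⟨j, by omega⟩) =
      -tensorCoords k m n x (⟨i, by omega⟩, ⟨j + 1, hj⟩) := by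
  have h := tensorCoords_jordanTensorSum k m n x ⟨i + 1, hi⟩ ⟨j + 1, hj⟩
  simp only [hx, map_zero, Pi.zero_apply, Nat.succ_pos, if_true, Nat.add_sub_cancel] at h
  linear_combination -h

lemma tensorCoords_zero_left (hx : jordanTensorSum k m n x = 0) {j : ℕ} (hm : 0 < m)
    (hj : j + 1 < n) : tensorCoords k m n x (⟨0, hm⟩, ⟨j, by omega⟩) = 0 := by
  have h := tensorCoords_jordanTensorSum k m n x ⟨0, hm⟩ ⟨j + 1, hj⟩
  simpa [hx] using h.symm

lemma tensorCoords_zero_right (hx : jordanTensorSum k m n x = 0) {i : ℕ} (hi : i + 1 < m)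
    (hn : 0 < n) : tensorCoords k m n x (⟨i, by omega⟩, ⟨0, hn⟩) = 0 := by
  have h := tensorCoords_jordanTensorSum k m n x ⟨i + 1, hi⟩ ⟨0, hn⟩
  simpa [hx] using h.symm

lemma tensorCoords_eq_zero_of_add_lt_right (hx : jordanTensorSum k m n x = 0) {i j : ℕ}
    (hi : i < m) (hj : j < n) (hij : i + j + 1 < n) :
    tensorCoords k m n x (⟨i, hi⟩, ⟨j, hj⟩) = 0 := by
  induction i generalizing j with
  | zero => exact tensorCoords_zero_left hx hi (by omega)
  | succ i ih =>
    rw [tensorCoords_succ_left hx hi (by omega), ih (by omega) (by omega) (by omega), neg_zero]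

lemma tensorCoords_eq_zero_of_add_lt_left (hx : jordanTensorSum k m n x = 0) {i j : ℕ}
    (hi : i < m) (hj : j < n) (hij : i + j + 1 < m) :
    tensorCoords k m n x (⟨i, hi⟩, ⟨j, hj⟩) = 0 := by
  induction j generalizing i with
  | zero => exact tensorCoords_zero_right hx (by omega) hj
  | succ j ih =>
    rw [← neg_eq_zero, ← tensorCoords_succ_left hx (by omega) hj]
    exact ih (by omega) (by omega) (by omega)

/-- An element of the kernel vanishes as soon as the last row of its coordinate matrix does. -/
lemma eq_zero_of_tensorCoords_last_row (hx : jordanTensorSum k m n x = 0) (hm : 1 ≤ m)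
    (hlast : ∀ (j : ℕ) (hj : j < n), max m n ≤ m + j →
      tensorCoords k m n x (⟨m - 1, by omega⟩, ⟨j, hj⟩) = 0) : x = 0 := by
  have key : ∀ (d i j : ℕ) (hi : i < m) (hj : j < n), i + d + 1 = m →
      tensorCoords k m n x (⟨i, hi⟩, ⟨j, hj⟩) = 0 := by
    intro d
    induction d with
    | zero =>
      intro i j hi hj hd
      by_cases h : max m n ≤ m + j
      · obtain rfl : i = m - 1 := by omega
        exact hlast j hj h
      · exact tensorCoords_eq_zero_of_add_lt_right hx hi hj (by omega)
    | succ d ih =>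
      intro i j hi hj hd
      cases j with
      | zero => exact tensorCoords_eq_zero_of_add_lt_left hx hi hj (by omega)
      | succ j =>
        rw [← neg_eq_zero, ← tensorCoords_succ_left hx (by omega) hj]
        exact ih _ _ _ _ (by omega)
  apply (tensorCoords k m n).injective
  rw [map_zero]
  ext ⟨⟨i, hi⟩, ⟨j, hj⟩⟩
  exact key (m - 1 - i) i j hi hj (by omega)

end Kernel

/-- The kernel of `T_{m,n}` is parametrised by the last `min m n` entries of the last row. -/
noncomputable def kerLastRow (k : Type) [Field k] (m n : ℕ) (hm : 1 ≤ m) :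
    LinearMap.ker (jordanTensorSum k m n) →ₗ[k] (Fin (min m n) → k) :=
  LinearMap.funLeft k k (fun t : Fin (min m n) =>
      ((⟨m - 1, by omega⟩, ⟨max m n - m + t, by omega⟩) : Fin m × Fin n)) ∘ₗ
    (tensorCoords k m n).toLinearMap ∘ₗ (LinearMap.ker (jordanTensorSum k m n)).subtype

lemma kerLastRow_apply (k : Type) [Field k] (m n : ℕ) (hm : 1 ≤ m)
    (x : LinearMap.ker (jordanTensorSum k m n)) (t : Fin (min m n)) :
    kerLastRow k m n hm x t =
      tensorCoords k m n x (⟨m - 1, by omega⟩, ⟨max m n - m + t, by omega⟩) := rfl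

lemma kerLastRow_injective (k : Type) [Field k] (m n : ℕ) (hm : 1 ≤ m) :
    Function.Injective (kerLastRow k m n hm) := by
  rw [injective_iff_map_eq_zero]
  rintro ⟨x, hx⟩ h
  refine Subtype.ext (eq_zero_of_tensorCoords_last_row hx hm fun j hj hmj => ?_)
  have ht := congrFun h ⟨j - (max m n - m), by omega⟩
  rw [kerLastRow_apply, Pi.zero_apply] at ht
  convert ht using 4
  simp only
  omega

lemma kerLastRow_surjective (k : Type) [Field k] (m n : ℕ) (hm : 1 ≤ m) :
    Function.Surjective (kerLastRow k m n hm) := by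
  intro b
  let c : ℕ → k := fun s =>
    if h : max m n ≤ s + 1 ∧ s + 1 - max m n < min m n then b ⟨s + 1 - max m n, h.2⟩ else 0
  have hc : ∀ s, s + 1 < max m n → c s = 0 := fun s hs => dif_neg (by omega)
  let a : Fin m × Fin n → k := fun p => (-1) ^ (m - 1 - (p.1 : ℕ)) * c (p.1 + p.2)
  have ha : jordanTensorSum k m n ((tensorCoords k m n).symm a) = 0 := by
    apply (tensorCoords k m n).injective
    rw [map_zero]
    ext ⟨⟨i, hi⟩, ⟨j, hj⟩⟩
    rw [tensorCoords_jordanTensorSum, LinearEquiv.apply_symm_apply]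
    simp only [a, Pi.zero_apply]
    rcases i with _ | i <;> rcases j with _ | j
    · simp
    · simp [hc j (by omega)]
    · simp [hc i (by omega)]
    · rw [if_pos (Nat.succ_pos _), if_pos (Nat.succ_pos _), Nat.add_sub_cancel,
        Nat.add_sub_cancel, show m - 1 - i = m - 1 - (i + 1) + 1 by omega,
        show i + 1 + j = i + (j + 1) by omega]
      ring
  refine ⟨⟨_, ha⟩, ?_⟩
  ext t
  rw [kerLastRow_apply, LinearEquiv.apply_symm_apply]
  have ht := t.2
  simp only [a, c, Nat.sub_self, pow_zero, one_mul]
  rw [dif_pos (by omega)]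
  congr 1
  ext
  simp only
  omega

/-- The kernel of `T_{m,n} = J_m ⊗ I_n + I_m ⊗ J_n` has dimension `min m n`; equivalently,
the Jordan normal form of `T_{m,n}` has exactly `min m n` blocks. -/
theorem ker_jordanTensorSum_finrank (k : Type) [Field k] (m n : ℕ) (hm : 1 ≤ m) (hn : 1 ≤ n) :
    Module.finrank k (LinearMap.ker (jordanTensorSum k m n)) = min m n := by
  rw [(LinearEquiv.ofBijective (kerLastRow k m n hm)
    ⟨kerLastRow_injective k m n hm, kerLastRow_surjective k m n hm⟩).finrank_eq]
  simp
end

section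
/- Let k be a field of characteristic p ≥ 0 and n ≥ 1 an integer. If p does not divide n (in particular if p = 0), then there is an isomorphism of k[X]-modules M_2 ⊗_k M_n ≅ M_{n−1} × M_{n+1} (with the convention M_0 = 0), where X acts on the tensor product as X⊗1 + 1⊗X. If p > 0 and p divides n, then instead M_2 ⊗_k M_n ≅ M_n × M_n. -/
open Polynomial TensorProduct

/-- `M_n := k[X]/(X^n)`, with the convention `M_0 = 0`. -/
abbrev Mq (k : Type) [Field k] (n : ℕ) : Type :=
  Polynomial k ⧸ Ideal.span {(Polynomial.X : Polynomial k) ^ n}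

/-- Multiplication by `X` on `M_n`, as a `k`-linear endomorphism. -/
noncomputable def mulX (k : Type) [Field k] (n : ℕ) : Module.End k (Mq k n) :=
  (LinearMap.lsmul (Polynomial k) (Mq k n) (Polynomial.X : Polynomial k)).restrictScalars k

/-- The endomorphism `X ⊗ 1 + 1 ⊗ X` of `M_m ⊗_k M_n`. -/
noncomputable def tensorX (k : Type) [Field k] (m n : ℕ) :
    Module.End k (TensorProduct k (Mq k m) (Mq k n)) :=
  TensorProduct.map (mulX k m) LinearMap.id + TensorProduct.map LinearMap.id (mulX k n)

theorem add_pow_succ_of_sq_eq_zero {R : Type*} [CommRing R] {ε : R} (hε : ε ^ 2 = 0) (x : R)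
    (m : ℕ) : (x + ε) ^ (m + 1) = x ^ (m + 1) + (m + 1) * x ^ m * ε := by
  induction m with
  | zero => simp
  | succ m ih =>
    rw [pow_succ, ih]
    push_cast
    linear_combination (m + 1) * x ^ m * hε

theorem congr_map_id_add_map_id {k V W B C : Type*} [CommRing k] [AddCommGroup V] [Module k V]
    [AddCommGroup W] [Module k W] [CommRing B] [Algebra k B] [CommRing C] [Algebra k C]
    {e : V ≃ₗ[k] B} {e' : W ≃ₗ[k] C} {f : Module.End k V} {g : Module.End k W} {b : B} {c : C}
    (hf : ∀ v, e (f v) = b * e v) (hg : ∀ w, e' (g w) = c * e' w) (t : V ⊗[k] W) :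
    TensorProduct.congr e e'
        ((TensorProduct.map f LinearMap.id + TensorProduct.map LinearMap.id g :
          Module.End k (V ⊗[k] W)) t) =
      ((1 : B) ⊗ₜ[k] c + b ⊗ₜ[k] (1 : C)) * TensorProduct.congr e e' t := by
  induction t with
  | zero => simp
  | add s t hs ht => simp only [map_add, mul_add, hs, ht]
  | tmul v w => simp [hf, hg, add_mul, add_comm]

section

variable (k : Type) [Field k]

theorem finite_Mq (n : ℕ) : Module.Finite k (Mq k n) :=
  (monic_X_pow (R := k) n).finite_quotient

theorem finrank_Mq (n : ℕ) : Module.finrank k (Mq k n) = n := by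
  simpa using finrank_quotient_span_eq_natDegree (f := (X : k[X]) ^ n)

/-- The `k[X]`-linear map `M_n → V` sending `1` to a vector killed by `X ^ n`. -/
noncomputable def liftMq {V : Type*} [AddCommGroup V] [Module k[X] V] (n : ℕ) (v : V)
    (hv : (X ^ n : k[X]) • v = 0) : Mq k n →ₗ[k[X]] V :=
  Submodule.liftQ _ (LinearMap.toSpanSingleton k[X] V v) <| by
    rw [Ideal.span, Submodule.span_le, Set.singleton_subset_iff]
    simpa using hv

theorem liftMq_one {V : Type*} [AddCommGroup V] [Module k[X] V] (n : ℕ) (v : V)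
    (hv : (X ^ n : k[X]) • v = 0) : liftMq k n v hv 1 = v :=
  one_smul k[X] v

/-- `M_n` as a vector space is the `k`-algebra obtained by adjoining a root of `X ^ n`. -/
noncomputable def equivAdjoinRoot (n : ℕ) : Mq k n ≃ₗ[k] AdjoinRoot ((X : k[X]) ^ n) where
  toFun a := a
  invFun a := a
  map_add' _ _ := rfl
  map_smul' _ _ := rfl
  left_inv _ := rfl
  right_inv _ := rfl

theorem equivAdjoinRoot_mulX (n : ℕ) (a : Mq k n) :
    equivAdjoinRoot k n (mulX k n a) = AdjoinRoot.root _ * equivAdjoinRoot k n a := by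
  obtain ⟨f, rfl⟩ := Ideal.Quotient.mk_surjective a
  rfl

/-- The tensor product of the algebras `k[X]/(X ^ m)` and `k[X]/(X ^ n)`. -/
abbrev TensorAlg (m n : ℕ) : Type :=
  AdjoinRoot ((X : k[X]) ^ m) ⊗[k] AdjoinRoot ((X : k[X]) ^ n)

/-- The generator `X ⊗ 1` of the algebra `k[X]/(X ^ m) ⊗ k[X]/(X ^ n)`. -/
noncomputable def leftRoot (m n : ℕ) : TensorAlg k m n := AdjoinRoot.root _ ⊗ₜ 1

/-- The generator `1 ⊗ X` of the algebra `k[X]/(X ^ m) ⊗ k[X]/(X ^ n)`. -/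
noncomputable def rightRoot (m n : ℕ) : TensorAlg k m n := 1 ⊗ₜ AdjoinRoot.root _

theorem root_X_pow_pow (n : ℕ) : AdjoinRoot.root ((X : k[X]) ^ n) ^ n = 0 := by
  simpa using AdjoinRoot.eval₂_root ((X : k[X]) ^ n)

theorem leftRoot_pow (m n : ℕ) : leftRoot k m n ^ m = 0 := by
  rw [leftRoot, Algebra.TensorProduct.tmul_pow, root_X_pow_pow, zero_tmul]

theorem rightRoot_pow (m n : ℕ) : rightRoot k m n ^ n = 0 := by
  rw [rightRoot, Algebra.TensorProduct.tmul_pow, root_X_pow_pow, tmul_zero]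

theorem adjoin_leftRoot_rightRoot (m n : ℕ) :
    Algebra.adjoin k {leftRoot k m n, rightRoot k m n} = ⊤ := by
  have hleft (a : AdjoinRoot ((X : k[X]) ^ m)) :
      a ⊗ₜ 1 ∈ Algebra.adjoin k {leftRoot k m n, rightRoot k m n} := by
    obtain ⟨f, rfl⟩ := AdjoinRoot.mk_surjective a
    have h := aeval_algHom_apply (Algebra.TensorProduct.includeLeft :
      AdjoinRoot ((X : k[X]) ^ m) →ₐ[k] TensorAlg k m n) (AdjoinRoot.root _) f
    rw [AdjoinRoot.aeval_eq] at h
    rw [← Algebra.TensorProduct.includeLeft_apply (R := k) (S := k), ← h]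
    exact Algebra.adjoin_mono (by simp [leftRoot]) (aeval_mem_adjoin_singleton k _)
  have hright (b : AdjoinRoot ((X : k[X]) ^ n)) :
      1 ⊗ₜ b ∈ Algebra.adjoin k {leftRoot k m n, rightRoot k m n} := by
    obtain ⟨f, rfl⟩ := AdjoinRoot.mk_surjective b
    have h := aeval_algHom_apply (Algebra.TensorProduct.includeRight :
      AdjoinRoot ((X : k[X]) ^ n) →ₐ[k] TensorAlg k m n) (AdjoinRoot.root _) f
    rw [AdjoinRoot.aeval_eq] at h
    rw [← Algebra.TensorProduct.includeRight_apply (R := k), ← h]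
    exact Algebra.adjoin_mono (by simp [rightRoot]) (aeval_mem_adjoin_singleton k _)
  rw [eq_top_iff]
  rintro a -
  induction a using TensorProduct.induction_on with
  | zero => exact zero_mem _
  | add a b ha hb => exact add_mem ha hb
  | tmul a b =>
    have := mul_mem (hleft a) (hright b)
    rwa [Algebra.TensorProduct.tmul_mul_tmul, mul_one, one_mul] at this

/-- `M_m ⊗ M_n` as a `k[X]`-module, with `X` acting as multiplication by an element of the
tensor product algebra. -/
noncomputable def tensorEquiv (m n : ℕ) : Module.AEval' (tensorX k m n) ≃ₗ[k[X]]
    Module.AEval k (TensorAlg k m n) (rightRoot k m n + leftRoot k m n) :=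
  LinearEquiv.ofAEval _
    ((TensorProduct.congr (equivAdjoinRoot k m) (equivAdjoinRoot k n)).trans
      (Module.AEval.of k (TensorAlg k m n) (rightRoot k m n + leftRoot k m n))) fun a =>
    (congrArg (Module.AEval.of k (TensorAlg k m n) (rightRoot k m n + leftRoot k m n))
      (congr_map_id_add_map_id (equivAdjoinRoot_mulX k m) (equivAdjoinRoot_mulX k n) a)).trans
      (Module.AEval.X_smul_of _ _).symm

end

section

variable {k A : Type} [Field k] [CommRing A] [Algebra k A]

theorem eq_top_of_one_mem_of_mem {x ε : A} (hε : ε ^ 2 = 0) (hA : Algebra.adjoin k {ε, x} = ⊤)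
    (N : Submodule k[X] (Module.AEval k A (x + ε))) (h1 : Module.AEval.of k A (x + ε) 1 ∈ N)
    (h : Module.AEval.of k A (x + ε) ε ∈ N) : N = ⊤ := by
  let P : Submodule k A :=
    (N.restrictScalars k).comap (Module.AEval.of k A (x + ε)).toLinearMap
  let S : Submodule k A := P ⊓ P.comap (LinearMap.mulLeft k ε)
  have hS (a : A) : a ∈ S ↔ a ∈ P ∧ ε * a ∈ P := Iff.rfl
  have hP (a : A) (ha : a ∈ P) : (x + ε) * a ∈ P := by
    have := N.smul_mem X ha
    change X • Module.AEval.of k A (x + ε) a ∈ N at this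
    rwa [Module.AEval.X_smul_of] at this
  have hSε (a : A) (ha : a ∈ S) : ε * a ∈ S := by
    refine ⟨ha.2, ?_⟩
    change ε * (ε * a) ∈ P
    rw [← mul_assoc, ← pow_two, hε, zero_mul]
    exact P.zero_mem
  have hSx (a : A) (ha : a ∈ S) : x * a ∈ S := by
    have hx : (x + ε) * a ∈ S :=
      (hS _).2 ⟨hP a ha.1, by rw [mul_left_comm]; exact hP _ ha.2⟩
    have := S.sub_mem hx (hSε a ha)
    rwa [add_mul, add_sub_cancel_right] at this
  have hmul (r : A) (hr : r ∈ Algebra.adjoin k {ε, x}) : ∀ a ∈ S, r * a ∈ S := by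
    induction hr using Algebra.adjoin_induction with
    | mem r hr =>
      obtain rfl | rfl := hr
      · exact hSε
      · exact hSx
    | algebraMap c =>
      intro a ha
      rw [← Algebra.smul_def]
      exact S.smul_mem c ha
    | add r s _ _ hr hs =>
      intro a ha
      rw [add_mul]
      exact S.add_mem (hr a ha) (hs a ha)
    | mul r s _ _ hr hs =>
      intro a ha
      rw [mul_assoc]
      exact hr _ (hs a ha)
  rw [eq_top_iff]
  intro b _
  obtain ⟨a, rfl⟩ := (Module.AEval.of k A (x + ε)).surjective b
  have := hmul a (hA ▸ Algebra.mem_top) 1 ((hS 1).2 ⟨h1, by rwa [mul_one]⟩)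
  rw [mul_one] at this
  exact this.1

theorem nonempty_linearEquiv_of_generators [Module.Finite k A] {x ε : A} (hε : ε ^ 2 = 0)
    (hA : Algebra.adjoin k {ε, x} = ⊤) {a b : ℕ} (hab : Module.finrank k A = a + b)
    (u v : Module.AEval k A (x + ε)) (hu : (X ^ a : k[X]) • u = 0)
    (hv : (X ^ b : k[X]) • v = 0)
    (h : ∀ N : Submodule k[X] (Module.AEval k A (x + ε)), u ∈ N → v ∈ N →
      Module.AEval.of k A (x + ε) 1 ∈ N ∧ Module.AEval.of k A (x + ε) ε ∈ N) :
    Nonempty (Module.AEval k A (x + ε) ≃ₗ[k[X]] (Mq k a × Mq k b)) := by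
  have := finite_Mq k
  let φ : (Mq k a × Mq k b) →ₗ[k[X]] Module.AEval k A (x + ε) :=
    (liftMq k a u hu).coprod (liftMq k b v hv)
  have hsurj : Function.Surjective φ := by
    rw [← LinearMap.range_eq_top]
    obtain ⟨h1, hl⟩ := h (LinearMap.range φ)
      ⟨(1, 0), by simp [φ, liftMq_one]⟩ ⟨(0, 1), by simp [φ, liftMq_one]⟩
    exact eq_top_of_one_mem_of_mem hε hA _ h1 hl
  have hrank : Module.finrank k (Mq k a × Mq k b) =
      Module.finrank k (Module.AEval k A (x + ε)) := by
    rw [← (Module.AEval.of k A (x + ε)).finrank_eq, Module.finrank_prod, finrank_Mq,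
      finrank_Mq, hab]
  have hinj : Function.Injective (φ.restrictScalars k) :=
    (LinearMap.injective_iff_surjective_of_finrank_eq_finrank hrank).2 hsurj
  exact ⟨(LinearEquiv.ofBijective φ ⟨hinj, hsurj⟩).symm⟩

theorem nonempty_linearEquiv_of_natCast_ne_zero [Module.Finite k A] {x ε : A} (hε : ε ^ 2 = 0)
    (hA : Algebra.adjoin k {ε, x} = ⊤) {m : ℕ} (hx : x ^ (m + 1) = 0)
    (hrank : Module.finrank k A = 2 * (m + 1)) (hm : ((m + 1 : ℕ) : k) ≠ 0) :
    Nonempty (Module.AEval k A (x + ε) ≃ₗ[k[X]] (Mq k m × Mq k (m + 2))) := by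
  refine nonempty_linearEquiv_of_generators hε hA (by omega)
    (Module.AEval.of k A (x + ε) (m * ε - x)) (Module.AEval.of k A (x + ε) 1) ?_ ?_ ?_
  · rw [Module.AEval.X_pow_smul_of, LinearEquiv.map_eq_zero_iff, smul_eq_mul]
    cases m with
    | zero => simpa using hx
    | succ l =>
      rw [add_pow_succ_of_sq_eq_zero hε]
      push_cast
      linear_combination -hx + (l + 1) ^ 2 * x ^ l * hε
  · rw [Module.AEval.X_pow_smul_of, LinearEquiv.map_eq_zero_iff, smul_eq_mul,
      add_pow_succ_of_sq_eq_zero hε]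
    push_cast
    linear_combination (x + (m + 1 + 1) * ε) * hx
  · intro N hu h1
    refine ⟨h1, ?_⟩
    have ht := N.smul_mem X h1
    rw [Module.AEval.X_smul_of] at ht
    have := N.smul_of_tower_mem ((m + 1 : ℕ) : k)⁻¹ (N.add_mem hu ht)
    rw [← map_add, ← map_smul] at this
    convert this using 2
    rw [eq_inv_smul_iff₀ hm, Algebra.smul_def, map_natCast, smul_eq_mul]
    push_cast
    ring

theorem nonempty_linearEquiv_of_natCast_eq_zero [Module.Finite k A] {x ε : A} (hε : ε ^ 2 = 0)
    (hA : Algebra.adjoin k {ε, x} = ⊤) {m : ℕ} (hx : x ^ (m + 1) = 0)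
    (hrank : Module.finrank k A = 2 * (m + 1)) (hm : ((m + 1 : ℕ) : k) = 0) :
    Nonempty (Module.AEval k A (x + ε) ≃ₗ[k[X]] (Mq k (m + 1) × Mq k (m + 1))) := by
  have hm' : (m + 1 : A) = 0 := by
    rw [← Nat.cast_succ, ← map_natCast (algebraMap k A), hm, map_zero]
  have ht : (x + ε) ^ (m + 1) = 0 := by
    rw [add_pow_succ_of_sq_eq_zero hε, hm', hx, zero_mul, zero_mul, add_zero]
  refine nonempty_linearEquiv_of_generators hε hA (by omega)
    (Module.AEval.of k A (x + ε) 1) (Module.AEval.of k A (x + ε) ε) ?_ ?_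
    fun N h1 hl => ⟨h1, hl⟩
  all_goals rw [Module.AEval.X_pow_smul_of, ht, zero_smul, map_zero]

end

/-- Over a field of characteristic `p ≥ 0`: if `p ∤ n` (in particular if `p = 0`) then
`M_2 ⊗_k M_n ≅ M_{n-1} × M_{n+1}` as `k[X]`-modules, where `X` acts on the tensor product
as `X⊗1 + 1⊗X`; if `p > 0` and `p ∣ n`, then instead `M_2 ⊗_k M_n ≅ M_n × M_n`. -/
theorem tensor_two_decomposition (k : Type) [Field k] (p : ℕ) [CharP k p]
    (n : ℕ) (hn : 1 ≤ n) :
    (¬ p ∣ n → Nonempty ((Module.AEval' (tensorX k 2 n)) ≃ₗ[Polynomial k]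
      (Mq k (n - 1) × Mq k (n + 1)))) ∧
    (0 < p → p ∣ n → Nonempty ((Module.AEval' (tensorX k 2 n)) ≃ₗ[Polynomial k]
      (Mq k n × Mq k n))) := by
  obtain ⟨m, rfl⟩ : ∃ m, n = m + 1 := ⟨n - 1, by omega⟩
  have := finite_Mq k
  have hfin (n : ℕ) : Module.Finite k (AdjoinRoot ((X : k[X]) ^ n)) :=
    Module.Finite.equiv (equivAdjoinRoot k n)
  have hrank : Module.finrank k (TensorAlg k 2 (m + 1)) = 2 * (m + 1) := by
    rw [Module.finrank_tensorProduct, ← (equivAdjoinRoot k 2).finrank_eq,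
      ← (equivAdjoinRoot k (m + 1)).finrank_eq, finrank_Mq, finrank_Mq]
  have hε := leftRoot_pow k 2 (m + 1)
  have hx := rightRoot_pow k 2 (m + 1)
  have hA := adjoin_leftRoot_rightRoot k 2 (m + 1)
  refine ⟨fun hp => ?_, fun _ hp => ?_⟩
  · obtain ⟨e⟩ := nonempty_linearEquiv_of_natCast_ne_zero hε hA hx hrank
      fun h => hp ((CharP.cast_eq_zero_iff k p _).1 h)
    exact ⟨(tensorEquiv k 2 (m + 1)).trans e⟩
  · obtain ⟨e⟩ := nonempty_linearEquiv_of_natCast_eq_zero hε hA hx hrank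
      ((CharP.cast_eq_zero_iff k p _).2 hp)
    exact ⟨(tensorEquiv k 2 (m + 1)).trans e⟩
end

section
/- Let k be a field of characteristic p > 0, let m, n ≥ 1 be integers, and let r ≥ 0 be an integer such that p divides the binomial coefficient C(m+n−2−a, m−1−b) for all integers 0 ≤ b ≤ a ≤ m+n−2−r. Then (x+y)^r lies in the ideal (x^m, y^n) of k[x,y]; equivalently T_{m,n}^r = 0, i.e., every Jordan block in the Jordan normal form of T_{m,n} has size at most r. -/
open TensorProduct

/-- If `a` and `b` commute, `a ^ m = 0`, `b ^ n = 0`, and the binomial coefficients of all remaining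
terms of `(a + b) ^ r` vanish, then `(a + b) ^ r = 0`. -/
theorem Commute.add_pow_eq_zero_of_choose {R : Type*} [Semiring R] {a b : R} (h : Commute a b)
    {m n r : ℕ} (ha : a ^ m = 0) (hb : b ^ n = 0)
    (hc : ∀ i ≤ r, i < m → r - i < n → (r.choose i : R) = 0) : (a + b) ^ r = 0 := by
  rw [h.add_pow]
  refine Finset.sum_eq_zero fun i hi => ?_
  rw [Finset.mem_range] at hi
  rcases le_or_gt m i with him | him
  · rw [pow_eq_zero_of_le him ha, zero_mul, zero_mul]
  rcases le_or_gt n (r - i) with hin | hin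
  · rw [pow_eq_zero_of_le hin hb, mul_zero, zero_mul]
  · rw [hc i (by lia) him hin, mul_zero]

theorem jordanBlock_pow_apply_eq_zero (k : Type) [Field k] (n s : ℕ) (v : Fin n → k) (i : Fin n)
    (hi : (i : ℕ) < s) : (jordanBlock k n ^ s) v i = 0 := by
  induction s generalizing i with
  | zero => lia
  | succ s ih =>
    rw [pow_succ', Module.End.mul_apply]
    generalize (jordanBlock k n ^ s) v = w at ih ⊢
    rw [jordanBlock, Matrix.toLin'_apply, Matrix.mulVec, dotProduct]
    refine Finset.sum_eq_zero fun j _ => ?_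
    rw [Matrix.of_apply]
    split_ifs with hij
    · rw [ih j (by lia), mul_zero]
    · rw [zero_mul]

theorem jordanBlock_pow_self (k : Type) [Field k] (n : ℕ) : jordanBlock k n ^ n = 0 :=
  LinearMap.ext fun v => funext fun i => jordanBlock_pow_apply_eq_zero k n n v i i.isLt

/-- Let `k` be a field of characteristic `p > 0` and `m, n ≥ 1`.  If `r ≥ 0` is such that `p`
divides `C(m+n-2-a, m-1-b)` for all `0 ≤ b ≤ a ≤ m+n-2-r` (where binomial coefficients with
negative lower index vanish, so only `b ≤ m-1` matters), then `(x+y)^r ∈ (x^m, y^n)` in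
`k[x,y]`; equivalently `T_{m,n}^r = 0`, i.e. all Jordan blocks of `T_{m,n}` have size `≤ r`. -/
theorem pow_add_mem_span_of_choose_dvd (k : Type) [Field k] (p : ℕ) [CharP k p] (hp : 0 < p)
    (m n : ℕ) (hm : 1 ≤ m) (hn : 1 ≤ n) (r : ℕ)
    (hdvd : ∀ a b : ℕ, b ≤ a → a + r ≤ m + n - 2 → b ≤ m - 1 →
      p ∣ (m + n - 2 - a).choose (m - 1 - b)) :
    (MvPolynomial.X 0 + MvPolynomial.X 1 : MvPolynomial (Fin 2) k) ^ r ∈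
        Ideal.span {(MvPolynomial.X 0 : MvPolynomial (Fin 2) k) ^ m,
          (MvPolynomial.X 1 : MvPolynomial (Fin 2) k) ^ n} ∧
      (jordanTensorSum k m n) ^ r = 0 := by
  have choose_eq_zero (i : ℕ) (hir : i ≤ r) (him : i < m) (hin : r - i < n) :
      (r.choose i : k) = 0 := by
    rw [CharP.cast_eq_zero_iff k p]
    convert hdvd (m + n - 2 - r) (m - 1 - i) (by lia) (by lia) (by lia) using 2 <;> lia
  constructor
  · rw [← Ideal.Quotient.eq_zero_iff_mem, map_pow, map_add]
    refine (Commute.all _ _).add_pow_eq_zero_of_choose (m := m) (n := n) ?_ ?_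
      fun i hir him hin => ?_
    · rw [← map_pow, Ideal.Quotient.eq_zero_iff_mem]
      exact Ideal.subset_span (by simp)
    · rw [← map_pow, Ideal.Quotient.eq_zero_iff_mem]
      exact Ideal.subset_span (by simp)
    · rw [← map_natCast (algebraMap k _), choose_eq_zero i hir him hin, map_zero]
  · refine Commute.add_pow_eq_zero_of_choose (m := m) (n := n) ?_ ?_ ?_ fun i hir him hin => ?_
    · rw [commute_iff_eq, Module.End.mul_eq_comp, Module.End.mul_eq_comp, ← TensorProduct.map_comp,
        ← TensorProduct.map_comp]
      simp only [LinearMap.comp_id, LinearMap.id_comp]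
    · rw [TensorProduct.map_pow, jordanBlock_pow_self, TensorProduct.map_zero_left]
    · rw [TensorProduct.map_pow, jordanBlock_pow_self, TensorProduct.map_zero_right]
    · rw [← map_natCast (algebraMap k _), choose_eq_zero i hir him hin, map_zero]
end

section
/- Let p be a prime number, ν ≥ 1 an integer, q = p^ν, and m an integer with 0 ≤ m ≤ q. Then for all integers 0 ≤ b ≤ a ≤ m−2, the prime p divides the binomial coefficient C(m+q−2−a, q−1−b). -/
/-- If `r < k < p ^ n`, then `p` divides `C(p ^ n + r, k)`. -/
theorem Nat.Prime.dvd_choose_pow_add {p : ℕ} (hp : p.Prime) {n r k : ℕ} (hrk : r < k)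
    (hk : k < p ^ n) : p ∣ (p ^ n + r).choose k := by
  rw [Nat.add_choose_eq]
  refine Finset.dvd_sum fun ij hij => ?_
  rw [Finset.HasAntidiagonal.mem_antidiagonal] at hij
  by_cases hi : ij.1 = 0
  · rw [Nat.choose_eq_zero_of_lt (show r < ij.2 by omega), mul_zero]
    exact dvd_zero p
  · exact (hp.dvd_choose_pow hi (by omega)).mul_right _

/-- Let `p` be a prime, `ν ≥ 1`, `q = p^ν`, and `0 ≤ m ≤ q`.  Then for all integers
`0 ≤ b ≤ a ≤ m - 2` (an inequality of integers, so such `a` exist only when `m ≥ 2`),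
the prime `p` divides the binomial coefficient `C(m+q-2-a, q-1-b)`. -/
theorem prime_dvd_choose_of_le_sub_two (p : ℕ) (hp : p.Prime) (ν : ℕ) (hν : 1 ≤ ν)
    (q : ℕ) (hq : q = p ^ ν) (m : ℕ) (hm : m ≤ q) :
    ∀ a b : ℕ, b ≤ a → (a : ℤ) ≤ (m : ℤ) - 2 →
      p ∣ Nat.choose (m + q - 2 - a) (q - 1 - b) := by
  intro a b hba ham
  subst hq
  rw [show m + p ^ ν - 2 - a = p ^ ν + (m - 2 - a) by omega]
  exact hp.dvd_choose_pow_add (by omega) (by omega)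
end

section
/- The set S is a subring of ℤ^{ν+1}, and it coincides with the set of ℤ-linear combinations of v_0, v_1, …, v_ν; equivalently, S is the subring of ℤ^{ν+1} generated by the elements v_0, …, v_ν. In other words, a tuple (b_0,…,b_ν) ∈ ℤ^{ν+1} lies in the ℤ-span of the v_i if and only if b_j ≡ b_{j−1} (mod p^j) for all 1 ≤ j ≤ ν. -/
/-- The subring `S ⊆ ℤ^{ν+1}` of tuples `(b_0,…,b_ν)` with `b_j ≡ b_{j-1} (mod p^j)`
for `1 ≤ j ≤ ν`. -/
def congrSubring (p ν : ℕ) : Subring (Fin (ν + 1) → ℤ) where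
  carrier := {b | ∀ j : Fin ν, (p : ℤ) ^ ((j : ℕ) + 1) ∣ b j.succ - b j.castSucc}
  zero_mem' := by intro j; simp
  one_mem' := by intro j; simp
  add_mem' := by
    intro a b ha hb j
    simpa [add_sub_add_comm] using dvd_add (ha j) (hb j)
  neg_mem' := by
    intro a ha j
    have h : (-a) j.succ - (-a) j.castSucc = -(a j.succ - a j.castSucc) := by
      simp only [Pi.neg_apply]; ring
    rw [h]
    exact (ha j).neg_right
  mul_mem' := by
    intro a b ha hb j
    have h : a j.succ * b j.succ - a j.castSucc * b j.castSucc
        = a j.succ * (b j.succ - b j.castSucc) + (a j.succ - a j.castSucc) * b j.castSucc := by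
      ring
    simpa [Pi.mul_apply, h] using dvd_add ((hb j).mul_left (a j.succ)) ((ha j).mul_right (b j.castSucc))

/-- The tuple whose coordinates are `0` in positions `< i` and `p ^ i` in positions `≥ i`. -/
def stepTuple (p ν : ℕ) (i : Fin (ν + 1)) : Fin (ν + 1) → ℤ :=
  fun j => if (i : ℕ) ≤ (j : ℕ) then (p : ℤ) ^ (i : ℕ) else 0

theorem stepTuple_succ_sub_castSucc (p ν : ℕ) (i : Fin (ν + 1)) (j : Fin ν) :
    stepTuple p ν i j.succ - stepTuple p ν i j.castSucc =
      if i = j.succ then (p : ℤ) ^ ((j : ℕ) + 1) else 0 := by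
  simp only [stepTuple, Fin.ext_iff, Fin.val_succ, Fin.val_castSucc]
  rcases lt_trichotomy (i : ℕ) ((j : ℕ) + 1) with h | h | h
  · rw [if_pos h.le, if_pos (Nat.lt_succ_iff.mp h), if_neg h.ne, sub_self]
  · simp [h]
  · rw [if_neg h.not_ge, if_neg (by lia), if_neg h.ne', sub_self]

theorem stepTuple_mem_congrSubring (p ν : ℕ) (i : Fin (ν + 1)) :
    stepTuple p ν i ∈ congrSubring p ν := by
  intro j
  rw [stepTuple_succ_sub_castSucc]
  split_ifs <;> simp

theorem mem_span_stepTuple {p ν : ℕ} {b : Fin (ν + 1) → ℤ} (hb : b ∈ congrSubring p ν) :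
    b ∈ Submodule.span ℤ (Set.range (stepTuple p ν)) := by
  choose c hc using hb
  rw [Submodule.mem_span_range_iff_exists_fun]
  refine ⟨Fin.cons (b 0) c, funext fun j => ?_⟩
  induction j using Fin.induction with
  | zero => simp [stepTuple]
  | succ j ih =>
    rw [← sub_left_inj (a := b j.castSucc), hc j]
    nth_rw 1 [← ih]
    simp only [Finset.sum_apply, Pi.smul_apply, smul_eq_mul, ← Finset.sum_sub_distrib, ← mul_sub,
      stepTuple_succ_sub_castSucc, mul_ite, mul_zero, Finset.sum_ite_eq',
      Finset.mem_univ, if_true, Fin.cons_succ]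
    exact mul_comm _ _

/-- The set `S = {(b_0,…,b_ν) : b_j ≡ b_{j-1} (mod p^j) for 1 ≤ j ≤ ν}` is a subring of
`ℤ^{ν+1}` (witnessed by `congrSubring`), and it coincides with the set of `ℤ`-linear
combinations of the elements `v_0,…,v_ν`, where `v_i` has coordinates `0` in positions
`< i` and `p^i` in positions `≥ i`: a tuple `(b_0,…,b_ν)` lies in that span if and only if
`p^j ∣ b_j - b_{j-1}` for all `1 ≤ j ≤ ν`. -/
theorem congrSubring_eq_span (p : ℕ) (hp : p.Prime) (ν : ℕ) :
    ((congrSubring p ν : Set (Fin (ν + 1) → ℤ)) =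
      {b | ∀ j : Fin ν, (p : ℤ) ^ ((j : ℕ) + 1) ∣ b j.succ - b j.castSucc}) ∧
    ((Submodule.span ℤ (Set.range fun i : Fin (ν + 1) =>
          fun j : Fin (ν + 1) => if (i : ℕ) ≤ (j : ℕ) then (p : ℤ) ^ (i : ℕ) else 0) :
        Set (Fin (ν + 1) → ℤ)) = (congrSubring p ν : Set (Fin (ν + 1) → ℤ))) := by
  refine ⟨rfl, Set.Subset.antisymm ?_ fun b hb => mem_span_stepTuple hb⟩
  change Submodule.span ℤ (Set.range (stepTuple p ν)) ≤
    (congrSubring p ν).toAddSubgroup.toIntSubmodule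
  rw [Submodule.span_le]
  rintro _ ⟨i, rfl⟩
  exact stepTuple_mem_congrSubring p ν i
end

section
/- The conductor of the ring extension S ⊂ ℤ^{ν+1} is the principal ideal of ℤ^{ν+1} generated by the element (p, p², …, p^{ν−1}, p^ν, p^ν); that is, an element c ∈ ℤ^{ν+1} satisfies c·a ∈ S for all a ∈ ℤ^{ν+1} if and only if c is a multiple (in ℤ^{ν+1}) of the tuple whose j-th coordinate is p^{j+1} for 0 ≤ j ≤ ν−1 and whose last coordinate is p^ν. -/
/-- The conductor of `S ⊂ ℤ^{ν+1}` is the principal ideal of `ℤ^{ν+1}` generated by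
`(p, p², …, p^{ν-1}, p^ν, p^ν)`: an element `c` satisfies `c·a ∈ S` for all
`a ∈ ℤ^{ν+1}` if and only if `c` is a multiple of the tuple whose `j`-th coordinate is
`p^{j+1}` for `0 ≤ j ≤ ν-1` and whose last coordinate is `p^ν`. -/
theorem conductor_congrSubring (p : ℕ) (hp : p.Prime) (ν : ℕ) (c : Fin (ν + 1) → ℤ) :
    (∀ a : Fin (ν + 1) → ℤ, c * a ∈ congrSubring p ν) ↔
      ∃ d : Fin (ν + 1) → ℤ, c = d *
        fun j : Fin (ν + 1) => if (j : ℕ) < ν then (p : ℤ) ^ ((j : ℕ) + 1) else (p : ℤ) ^ ν := by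
  constructor
  · intro h
    have hdvd : ∀ i : Fin (ν + 1),
        (if (i : ℕ) < ν then (p : ℤ) ^ ((i : ℕ) + 1) else (p : ℤ) ^ ν) ∣ c i := by
      intro i
      have hi : ∀ j : Fin ν, (p : ℤ) ^ ((j : ℕ) + 1) ∣
          (c * Pi.single i 1 : Fin (ν + 1) → ℤ) j.succ -
            (c * Pi.single i 1 : Fin (ν + 1) → ℤ) j.castSucc := h (Pi.single i 1)
      induction i using Fin.lastCases with
      | cast i =>
        have hne : i.succ ≠ i.castSucc := Fin.castSucc_lt_succ.ne'
        simpa [Pi.single_apply, hne] using hi i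
      | last =>
        cases ν with
        | zero => simp
        | succ n =>
          have hne : (Fin.last n).castSucc ≠ Fin.last (n + 1) := (Fin.castSucc_lt_last _).ne
          simpa [Pi.single_apply, hne] using hi (Fin.last n)
    choose d hd using hdvd
    exact ⟨d, funext fun i => by rw [hd i, Pi.mul_apply, mul_comm]⟩
  · rintro ⟨d, rfl⟩ a j
    simp only [Pi.mul_apply]
    refine dvd_sub (Dvd.dvd.mul_right (Dvd.dvd.mul_left ?_ _) _)
      (Dvd.dvd.mul_right (Dvd.dvd.mul_left ?_ _) _)
    · split_ifs
      · exact pow_dvd_pow _ (by simp)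
      · exact pow_dvd_pow _ j.isLt
    · simp
end

section
/- The quotient of S by the ideal generated by p (i.e., the fiber ring S ⊗_ℤ 𝔽_p) is isomorphic as an 𝔽_p-algebra to the local Artin ring 𝔽_p[x_1,…,x_ν]/(x_1,…,x_ν)², the quotient of the polynomial ring in ν variables over 𝔽_p by the square of the ideal generated by the variables. -/
namespace congrSubring

variable {p ν : ℕ}

/-- The divided difference `(b_{j+1} - b_j) / p^{j+1}` of a tuple in `congrSubring p ν`. -/
def dividedDiff (b : congrSubring p ν) (j : Fin ν) : ℤ :=
  (b.1 j.succ - b.1 j.castSucc) / (p : ℤ) ^ ((j : ℕ) + 1)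

lemma pow_mul_dividedDiff (b : congrSubring p ν) (j : Fin ν) :
    (p : ℤ) ^ ((j : ℕ) + 1) * dividedDiff b j = b.1 j.succ - b.1 j.castSucc :=
  Int.mul_ediv_cancel' (b.2 j)

lemma dividedDiff_eq_of_pow_mul_eq (hp : p.Prime) {b : congrSubring p ν} {j : Fin ν} {d : ℤ}
    (h : (p : ℤ) ^ ((j : ℕ) + 1) * d = b.1 j.succ - b.1 j.castSucc) : dividedDiff b j = d :=
  mul_left_cancel₀ (pow_ne_zero _ (Int.natCast_ne_zero.mpr hp.ne_zero))
    ((pow_mul_dividedDiff b j).trans h.symm)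

lemma cast_apply_eq_cast_apply_zero (b : congrSubring p ν) (k : Fin (ν + 1)) :
    (b.1 k : ZMod p) = b.1 0 := by
  induction k using Fin.induction with
  | zero => rfl
  | succ j ih =>
    rw [← ih, ← sub_eq_zero, ← Int.cast_sub, ← pow_mul_dividedDiff]
    simp [pow_succ]

/-- Reduction modulo `p`: the first coordinate together with the divided differences. -/
def toTrivSqZeroExt (p ν : ℕ) (hp : p.Prime) :
    congrSubring p ν →+* TrivSqZeroExt (ZMod p) (Fin ν → ZMod p) where
  toFun b := TrivSqZeroExt.inl (b.1 0 : ZMod p) +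
    TrivSqZeroExt.inr fun j => (dividedDiff b j : ZMod p)
  map_zero' := by
    ext j
    · simp
    · have : dividedDiff (0 : congrSubring p ν) j = 0 := dividedDiff_eq_of_pow_mul_eq hp (by simp)
      simp [this]
  map_one' := by
    ext j
    · simp
    · have : dividedDiff (1 : congrSubring p ν) j = 0 := dividedDiff_eq_of_pow_mul_eq hp (by simp)
      simp [this]
  map_add' a b := by
    ext j
    · simp
    · have : dividedDiff (a + b) j = dividedDiff a j + dividedDiff b j := by
        refine dividedDiff_eq_of_pow_mul_eq hp ?_
        rw [mul_add, pow_mul_dividedDiff, pow_mul_dividedDiff]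
        simp only [Subring.coe_add, Pi.add_apply]
        ring
      simp [this]
  map_mul' a b := by
    ext j
    · simp
    · have : dividedDiff (a * b) j =
          a.1 j.succ * dividedDiff b j + b.1 j.castSucc * dividedDiff a j := by
        refine dividedDiff_eq_of_pow_mul_eq hp ?_
        rw [mul_add, mul_left_comm, pow_mul_dividedDiff, mul_left_comm, pow_mul_dividedDiff]
        simp only [Subring.coe_mul, Pi.mul_apply]
        ring
      simp [this, cast_apply_eq_cast_apply_zero, mul_comm]

lemma toTrivSqZeroExt_surjective (hp : p.Prime) :
    Function.Surjective (toTrivSqZeroExt p ν hp) := by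
  intro t
  obtain ⟨c, hc⟩ := ZMod.intCast_surjective t.fst
  choose v hv using fun j => ZMod.intCast_surjective (t.snd j)
  let f : Fin ν → ℤ := fun j => (p : ℤ) ^ ((j : ℕ) + 1) * v j
  have hf (j : Fin ν) : (c + Fin.partialSum f j.succ) - (c + Fin.partialSum f j.castSucc) =
      (p : ℤ) ^ ((j : ℕ) + 1) * v j := by
    rw [Fin.partialSum_succ]
    ring
  let b : congrSubring p ν := ⟨fun k => c + Fin.partialSum f k, fun j => ⟨v j, hf j⟩⟩
  have hb (j : Fin ν) : dividedDiff b j = v j := dividedDiff_eq_of_pow_mul_eq hp (hf j).symm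
  refine ⟨b, ?_⟩
  ext j
  · simp [toTrivSqZeroExt, b, hc]
  · simp [toTrivSqZeroExt, hb, hv]

lemma ker_toTrivSqZeroExt (hp : p.Prime) :
    RingHom.ker (toTrivSqZeroExt p ν hp) = Ideal.span {((p : ℕ) : congrSubring p ν)} := by
  apply le_antisymm
  · intro b hb
    rw [RingHom.mem_ker] at hb
    have h0 : (b.1 0 : ZMod p) = 0 := by
      simpa [toTrivSqZeroExt] using congrArg TrivSqZeroExt.fst hb
    have hd (j : Fin ν) : (dividedDiff b j : ZMod p) = 0 := by
      simpa [toTrivSqZeroExt] using congrFun (congrArg TrivSqZeroExt.snd hb) j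
    choose c hc using fun k => (ZMod.intCast_zmod_eq_zero_iff_dvd (b.1 k) p).mp
      ((cast_apply_eq_cast_apply_zero b k).trans h0)
    choose d hd using fun j => (ZMod.intCast_zmod_eq_zero_iff_dvd _ p).mp (hd j)
    have hp0 : (p : ℤ) ≠ 0 := Int.natCast_ne_zero.mpr hp.ne_zero
    have hmem : c ∈ congrSubring p ν := fun j => by
      refine ⟨d j, mul_left_cancel₀ hp0 ?_⟩
      rw [mul_sub, ← hc, ← hc, ← pow_mul_dividedDiff, hd]
      ring
    refine Ideal.mem_span_singleton.mpr ⟨⟨c, hmem⟩, ?_⟩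
    ext k
    simpa using hc k
  · rw [Ideal.span_singleton_le_iff_mem, RingHom.mem_ker, map_natCast]
    ext j <;> simp

/-- The reduction of `congrSubring p ν` modulo `p` is a trivial square-zero extension of
`ZMod p`. -/
noncomputable def quotientEquivTrivSqZeroExt (p ν : ℕ) (hp : p.Prime) :
    (congrSubring p ν ⧸ Ideal.span {((p : ℕ) : congrSubring p ν)}) ≃+*
      TrivSqZeroExt (ZMod p) (Fin ν → ZMod p) :=
  (Ideal.quotEquivOfEq (ker_toTrivSqZeroExt hp).symm).trans
    (RingHom.quotientKerEquivOfSurjective (toTrivSqZeroExt_surjective hp))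

end congrSubring

section MvPolynomial

variable (R σ : Type*) [CommRing R]

/-- The ideal of a polynomial ring generated by the variables. -/
local notation "𝔪" => Ideal.span (Set.range (MvPolynomial.X : σ → MvPolynomial σ R))

/-- The quotient of a polynomial ring by the square of the ideal of the variables is a trivial
square-zero extension. -/
noncomputable def mvPolynomialQuotientSqEquivTrivSqZeroExt [Fintype σ] [DecidableEq σ] :
    (MvPolynomial σ R ⧸ 𝔪 ^ 2) ≃ₐ[R] TrivSqZeroExt R (σ → R) :=
  let φ : MvPolynomial σ R →ₐ[R] TrivSqZeroExt R (σ → R) :=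
    MvPolynomial.aeval fun i => TrivSqZeroExt.inr (Pi.single i 1)
  have hφ : ∀ f ∈ 𝔪 ^ 2, φ f = 0 := by
    change 𝔪 ^ 2 ≤ RingHom.ker φ
    rw [pow_two, Ideal.span_mul_span', Ideal.span_le]
    rintro _ ⟨_, ⟨i, rfl⟩, _, ⟨j, rfl⟩, rfl⟩
    simp [φ, RingHom.mem_ker]
  let ψ : (σ → R) →ₗ[R] MvPolynomial σ R ⧸ 𝔪 ^ 2 :=
    Fintype.linearCombination R fun i => Ideal.Quotient.mk (𝔪 ^ 2) (MvPolynomial.X i)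
  have hψ (v w : σ → R) : ψ v * ψ w = 0 := by
    simp only [ψ, Fintype.linearCombination_apply, Finset.sum_mul_sum]
    refine Finset.sum_eq_zero fun i _ => Finset.sum_eq_zero fun j _ => ?_
    rw [smul_mul_smul_comm, ← map_mul, Ideal.Quotient.eq_zero_iff_mem.mpr, smul_zero]
    rw [pow_two]
    exact Ideal.mul_mem_mul (Ideal.subset_span ⟨i, rfl⟩) (Ideal.subset_span ⟨j, rfl⟩)
  AlgEquiv.ofAlgHom (Ideal.Quotient.liftₐ (𝔪 ^ 2) φ hφ) (TrivSqZeroExt.liftEquivOfComm ⟨ψ, hψ⟩)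
    (by
      ext i : 3
      have hX : TrivSqZeroExt.liftEquivOfComm ⟨ψ, hψ⟩ (TrivSqZeroExt.inr (Pi.single i 1)) =
          Ideal.Quotient.mk (𝔪 ^ 2) (MvPolynomial.X i) := by
        simp [ψ]
      change Ideal.Quotient.liftₐ (𝔪 ^ 2) φ hφ
        (TrivSqZeroExt.liftEquivOfComm ⟨ψ, hψ⟩ (TrivSqZeroExt.inr (Pi.single i 1))) = _
      rw [hX]
      exact MvPolynomial.aeval_X _ i)
    (by
      apply Ideal.Quotient.algHom_ext
      ext i
      change TrivSqZeroExt.liftEquivOfComm ⟨ψ, hψ⟩ (φ (MvPolynomial.X i)) = _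
      simp [φ, ψ])

end MvPolynomial

/-- The fiber ring `S ⊗_ℤ 𝔽_p = S/pS` is isomorphic to the local Artin ring
`𝔽_p[x_1,…,x_ν]/(x_1,…,x_ν)²`.  (Both sides are `𝔽_p`-algebras and any ring isomorphism
between them is automatically an `𝔽_p`-algebra isomorphism.) -/
theorem congrSubring_mod_p (p : ℕ) (hp : p.Prime) (ν : ℕ) :
    Nonempty ((congrSubring p ν ⧸ Ideal.span {((p : ℕ) : congrSubring p ν)}) ≃+*
      (MvPolynomial (Fin ν) (ZMod p) ⧸
        (Ideal.span (Set.range (MvPolynomial.X : Fin ν → MvPolynomial (Fin ν) (ZMod p)))) ^ 2)) := by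
  exact ⟨(congrSubring.quotientEquivTrivSqZeroExt p ν hp).trans
    (mvPolynomialQuotientSqEquivTrivSqZeroExt (ZMod p) (Fin ν)).symm.toRingEquiv⟩
end

section
/- The prime spectrum of the ring A, equipped with the Zariski topology, is homeomorphic to the Alexandroff (one-point) compactification of the countable discrete space ℕ. -/
/-- The subring `A` of `∏_{i∈ℕ} ℚ` consisting of the almost constant sequences, i.e.
sequences `(a_0, a_1, …)` of rationals with `a_i = a_{i+1} = …` for some index `i`. -/
def almostConstant : Subring (ℕ → ℚ) where
  carrier := {a | ∃ N : ℕ, ∀ n : ℕ, N ≤ n → a n = a N}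
  zero_mem' := ⟨0, fun _ _ => rfl⟩
  one_mem' := ⟨0, fun _ _ => rfl⟩
  add_mem' := by
    rintro a b ⟨Na, ha⟩ ⟨Nb, hb⟩
    refine ⟨max Na Nb, fun n hn => ?_⟩
    have h1 : a n = a (max Na Nb) := by
      rw [ha n (le_trans (le_max_left _ _) hn), ha (max Na Nb) (le_max_left _ _)]
    have h2 : b n = b (max Na Nb) := by
      rw [hb n (le_trans (le_max_right _ _) hn), hb (max Na Nb) (le_max_right _ _)]
    simp [Pi.add_apply, h1, h2]
  neg_mem' := by
    rintro a ⟨Na, ha⟩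
    exact ⟨Na, fun n hn => by simp [Pi.neg_apply, ha n hn]⟩
  mul_mem' := by
    rintro a b ⟨Na, ha⟩ ⟨Nb, hb⟩
    refine ⟨max Na Nb, fun n hn => ?_⟩
    have h1 : a n = a (max Na Nb) := by
      rw [ha n (le_trans (le_max_left _ _) hn), ha (max Na Nb) (le_max_left _ _)]
    have h2 : b n = b (max Na Nb) := by
      rw [hb n (le_trans (le_max_right _ _) hn), hb (max Na Nb) (le_max_right _ _)]
    simp [Pi.mul_apply, h1, h2]

open Filter Topology

namespace almostConstant

theorem exists_eventually_eq (a : almostConstant) : ∃ c : ℚ, ∀ᶠ n in atTop, a.1 n = c := by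
  obtain ⟨a, N, hN⟩ := a
  exact ⟨a N, eventually_atTop.2 ⟨N, hN⟩⟩

/-- The eventual value of an almost constant sequence. -/
noncomputable def limit (a : almostConstant) : ℚ := (exists_eventually_eq a).choose

theorem eventually_eq_limit (a : almostConstant) : ∀ᶠ n in atTop, a.1 n = limit a :=
  (exists_eventually_eq a).choose_spec

theorem limit_eq_of_eventually_eq {a : almostConstant} {c : ℚ}
    (h : ∀ᶠ n in atTop, a.1 n = c) : limit a = c := by
  obtain ⟨n, h₁, h₂⟩ := ((eventually_eq_limit a).and h).exists
  exact h₁.symm.trans h₂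

/-- The eventual value, as a ring homomorphism. -/
noncomputable def limitHom : almostConstant →+* ℚ where
  toFun := limit
  map_one' := limit_eq_of_eventually_eq (.of_forall fun _ => rfl)
  map_zero' := limit_eq_of_eventually_eq (.of_forall fun _ => rfl)
  map_add' a b := limit_eq_of_eventually_eq <| by
    filter_upwards [eventually_eq_limit a, eventually_eq_limit b] with n ha hb
    simp [ha, hb]
  map_mul' a b := limit_eq_of_eventually_eq <| by
    filter_upwards [eventually_eq_limit a, eventually_eq_limit b] with n ha hb
    simp [ha, hb]

/-- Evaluation of almost constant sequences at a point of `OnePoint ℕ`. -/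
noncomputable def eval (x : OnePoint ℕ) : almostConstant →+* ℚ :=
  x.elim limitHom fun n => (Pi.evalRingHom (fun _ : ℕ => ℚ) n).comp almostConstant.subtype

@[simp]
theorem eval_coe (n : ℕ) (a : almostConstant) : eval n a = a.1 n := rfl

@[simp]
theorem eval_infty (a : almostConstant) : eval OnePoint.infty a = limit a := rfl

/-- The sequence with value `c` at `n` and `0` elsewhere. -/
def single (n : ℕ) (c : ℚ) : almostConstant :=
  ⟨Pi.single n c, n + 1, fun m hm => by
    rw [Pi.single_eq_of_ne (by omega), Pi.single_eq_of_ne (by omega)]⟩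

@[simp]
theorem coe_single (n : ℕ) (c : ℚ) : (single n c).1 = Pi.single n c := rfl

theorem limit_single (n : ℕ) (c : ℚ) : limit (single n c) = 0 :=
  limit_eq_of_eventually_eq <| (eventually_gt_atTop n).mono fun m hm => by
    simp [hm.ne']

theorem single_mul (n : ℕ) (c : ℚ) (a : almostConstant) :
    single n c * a = single n (c * a.1 n) := by
  ext m
  by_cases h : m = n
  · subst h; simp
  · simp [h]

theorem eval_surjective (x : OnePoint ℕ) : Function.Surjective (eval x) := fun c => by
  refine ⟨⟨fun _ => c, 0, fun _ _ => rfl⟩, ?_⟩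
  induction x using OnePoint.rec with
  | infty => exact limit_eq_of_eventually_eq (.of_forall fun _ => rfl)
  | coe n => rfl

theorem ker_eval_injective : Function.Injective fun x => RingHom.ker (eval x) := by
  have key (n : ℕ) (y : OnePoint ℕ) (h : (n : OnePoint ℕ) ≠ y) :
      RingHom.ker (eval n) ≠ RingHom.ker (eval y) := by
    have h₁ : single n 1 ∉ RingHom.ker (eval n) := by simp [RingHom.mem_ker]
    have h₂ : single n 1 ∈ RingHom.ker (eval y) := by
      induction y using OnePoint.rec with
      | infty => simp [RingHom.mem_ker, limit_single]
      | coe m =>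
        have : m ≠ n := fun hm => h (by rw [hm])
        simp [RingHom.mem_ker, this]
    exact fun e => h₁ (e ▸ h₂)
  intro x y h
  by_contra hxy
  induction x using OnePoint.rec with
  | coe n => exact key n y hxy h
  | infty =>
    induction y using OnePoint.rec with
    | coe m => exact key m _ (Ne.symm hxy) h.symm
    | infty => exact hxy rfl

theorem mem_of_limit_eq_zero {I : Ideal almostConstant} (hI : ∀ n, single n 1 ∈ I)
    {a : almostConstant} (ha : limit a = 0) : a ∈ I := by
  obtain ⟨N, hN⟩ := eventually_atTop.1 (eventually_eq_limit a)
  have : a = ∑ i ∈ Finset.range N, single i 1 * a := by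
    ext m
    simp only [single_mul, AddSubmonoidClass.coe_finsetSum, Finset.sum_apply, coe_single, one_mul]
    by_cases hm : m < N
    · simp [Finset.sum_pi_single, hm]
    · simp [Finset.sum_pi_single, hm, hN m (not_lt.1 hm), ha]
  rw [this]
  exact I.sum_mem fun i _ => I.mul_mem_right _ (hI i)

theorem exists_ker_eval_eq (p : Ideal almostConstant) [hp : p.IsPrime] :
    ∃ x, RingHom.ker (eval x) = p := by
  suffices ∃ x, RingHom.ker (eval x) ≤ p from this.imp fun x hx =>
    (RingHom.ker_isMaximal_of_surjective _ (eval_surjective x)).eq_of_le hp.ne_top hx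
  by_cases h : ∀ n, single n 1 ∈ p
  · exact ⟨OnePoint.infty, fun a ha => mem_of_limit_eq_zero h ha⟩
  · push Not at h
    obtain ⟨n, hn⟩ := h
    refine ⟨n, fun a ha => (hp.mem_or_mem (x := single n 1) ?_).resolve_left hn⟩
    have ha' : a.1 n = 0 := ha
    have : single n 1 * a = 0 := by
      ext m
      simp [single_mul, ha']
    exact this ▸ p.zero_mem

/-- The point of the prime spectrum of `almostConstant` given by evaluation at `x`. -/
noncomputable def primeSpectrumPoint (x : OnePoint ℕ) : PrimeSpectrum almostConstant :=
  ⟨RingHom.ker (eval x), RingHom.ker_isPrime _⟩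

theorem primeSpectrumPoint_bijective : Function.Bijective primeSpectrumPoint :=
  ⟨fun _ _ h => ker_eval_injective (congrArg PrimeSpectrum.asIdeal h), fun p =>
    (exists_ker_eval_eq p.asIdeal).imp fun _ hx => PrimeSpectrum.ext hx⟩

theorem continuous_primeSpectrumPoint : Continuous primeSpectrumPoint := by
  rw [OnePoint.continuous_iff_from_nat,
    PrimeSpectrum.isTopologicalBasis_basic_opens.nhds_hasBasis.tendsto_right_iff]
  rintro _ ⟨⟨a, rfl⟩, ha⟩
  filter_upwards [eventually_eq_limit a] with n hn
  have ha' : limit a ≠ 0 := ha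
  exact show a.1 n ≠ 0 from hn ▸ ha'

/-- Basic open sets are clopen, since the pointwise inverse `b` of `a` is almost constant and
`1 - a * b` vanishes exactly on the support of `a`. -/
theorem isClopen_basicOpen (a : almostConstant) :
    IsClopen (PrimeSpectrum.basicOpen a : Set (PrimeSpectrum almostConstant)) := by
  have hmem : (fun n => (a.1 n)⁻¹) ∈ almostConstant := by
    obtain ⟨N, hN⟩ := a.2
    exact ⟨N, fun n hn => congrArg _ (hN n hn)⟩
  let b : almostConstant := ⟨_, hmem⟩
  have hab : a * (1 - a * b) = 0 := by
    ext n
    by_cases h : a.1 n = 0 <;> simp [b, h]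
  refine ⟨?_, PrimeSpectrum.isOpen_basicOpen⟩
  have : (PrimeSpectrum.basicOpen a : Set (PrimeSpectrum almostConstant))ᶜ =
      PrimeSpectrum.basicOpen (1 - a * b) := by
    ext p
    simp only [Set.mem_compl_iff, SetLike.mem_coe, PrimeSpectrum.mem_basicOpen, not_not]
    refine ⟨fun h h' => p.2.ne_top ?_, fun h => ?_⟩
    · rw [Ideal.eq_top_iff_one]
      simpa using p.asIdeal.add_mem h' (p.asIdeal.mul_mem_right b h)
    · exact (p.2.mem_or_mem (hab ▸ p.asIdeal.zero_mem)).resolve_right h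
  rw [← isOpen_compl_iff, this]
  exact PrimeSpectrum.isOpen_basicOpen

instance : T2Space (PrimeSpectrum almostConstant) := by
  refine ⟨fun p q hpq => ?_⟩
  obtain ⟨a, ha⟩ : ∃ a, ¬ (a ∈ p.asIdeal ↔ a ∈ q.asIdeal) := by
    by_contra! h
    exact hpq (PrimeSpectrum.ext (Ideal.ext h))
  have hc := isClopen_basicOpen a
  by_cases hp : a ∈ p.asIdeal
  · exact ⟨_, _, hc.compl.isOpen, hc.isOpen, fun h => h hp, fun h => ha (iff_of_true hp h),
      disjoint_compl_left⟩
  · exact ⟨_, _, hc.isOpen, hc.compl.isOpen, hp, fun h => ha (iff_of_false hp h),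
      disjoint_compl_right⟩

end almostConstant

/-- The prime spectrum of the ring of almost constant sequences of rationals, with the
Zariski topology, is homeomorphic to the Alexandroff (one-point) compactification of the
countable discrete space `ℕ`. -/
theorem primeSpectrum_almostConstant_homeo :
    Nonempty (PrimeSpectrum almostConstant ≃ₜ OnePoint ℕ) := by
  exact ⟨(Continuous.homeoOfEquivCompactToT2
    (f := Equiv.ofBijective _ almostConstant.primeSpectrumPoint_bijective)
    almostConstant.continuous_primeSpectrumPoint).symm⟩
end

section
/- The ring A has Krull dimension zero. -/
/-- A commutative ring in which every element `x` satisfies `x * x * y = x` for some `y`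
(a von Neumann regular ring) has Krull dimension at most zero. -/
theorem Ring.KrullDimLE.of_forall_exists_mul_mul_eq {R : Type*} [CommRing R]
    (h : ∀ x : R, ∃ y, x * x * y = x) : Ring.KrullDimLE 0 R := by
  refine .mk₀ fun I hI => Ideal.isMaximal_iff.2 ⟨I.ne_top_iff_one.1 hI.ne_top, ?_⟩
  intro J x hIJ hxI hxJ
  obtain ⟨y, hy⟩ := h x
  have hmem : x * (1 - x * y) ∈ I := by
    have : x * (1 - x * y) = 0 := by linear_combination -hy
    exact this ▸ I.zero_mem
  have h1 : 1 - x * y ∈ J := hIJ ((hI.mem_or_mem hmem).resolve_left hxI)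
  simpa using J.add_mem h1 (J.mul_mem_right y hxJ)

theorem inv_mem_almostConstant {a : ℕ → ℚ} (ha : a ∈ almostConstant) :
    a⁻¹ ∈ almostConstant := by
  obtain ⟨N, hN⟩ := ha
  exact ⟨N, fun n hn => congrArg (·⁻¹) (hN n hn)⟩

/-- The ring of almost constant sequences of rationals has Krull dimension zero. -/
theorem ringKrullDim_almostConstant : ringKrullDim almostConstant = 0 := by
  rw [← ringKrullDimZero_iff_ringKrullDim_eq_zero]
  refine .of_forall_exists_mul_mul_eq fun x => ⟨⟨_, inv_mem_almostConstant x.2⟩, ?_⟩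
  ext n
  exact mul_self_mul_inv (x.1 n)
end
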